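/- Let X₀ ∈ ℝ^{n×k}, let q ≥ 1 be an integer, let ρ: ℝ → ℝ, and set X = Q ρ(Λ)^q Qᵀ X₀ (i.e., X = ρ(A)^q X₀). Assume the ordering condition min_{1≤j≤k}|ρ(λ_j)| = |ρ(λ_k)| ≥ |ρ(λ_{k+1})| ≥ ⋯ ≥ |ρ(λ_{m+1})| = max_{m<j≤n}|ρ(λ_j)| with |ρ(λ_k)| > 0, and assume min_{i≤k} ‖q_iᵀX₀‖₂ > 0 and min_{i≤k} ‖e_iᵀV‖₂ > 0. Then under the G₁-Assumption, δ_k(Y) ≤ c_m · |ρ(λ_{m+1})/ρ(λ_k)|^q, where c_m = Γ_{k,m}(QᵀX₀) · Γ_{k,m}(V) · ‖G₁† E_k‖₂ and ‖·‖₂ on a matrix denotes the spectral norm. -/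

import Mathlib

open Matrix

namespace ARR

/-- Euclidean norm of the `i`-th row of a matrix. -/
noncomputable def rowNorm {R C : Type*} [Fintype C] (M : Matrix R C ℝ) (i : R) : ℝ :=
  Real.sqrt (∑ j, M i j ^ 2)

/-- Supremum of `f` over indices satisfying `P`. -/
noncomputable def supOver {n : ℕ} (P : Fin n → Prop) (f : Fin n → ℝ) : ℝ :=
  sSup (f '' {i | P i})

/-- Infimum of `f` over indices satisfying `P`. -/
noncomputable def infOver {n : ℕ} (P : Fin n → Prop) (f : Fin n → ℝ) : ℝ :=
  sInf (f '' {i | P i})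

/-- The accuracy measure `δₖ(Z) = max_{i>k} ‖qᵢᵀZ‖ / min_{i≤k} ‖qᵢᵀZ‖`
(indices are 1-based in the paper; here `i > k` means `k ≤ i` for 0-based `i`). -/
noncomputable def deltaK {n k : ℕ} (Q : Matrix (Fin n) (Fin n) ℝ)
    (Z : Matrix (Fin n) (Fin k) ℝ) : ℝ :=
  supOver (fun i => k ≤ (i : ℕ)) (rowNorm (Qᵀ * Z)) /
    infOver (fun i => (i : ℕ) < k) (rowNorm (Qᵀ * Z))

/-- `Γ_{k,m}(M) = max_{i>m} ‖eᵢᵀM‖ / min_{i≤k} ‖eᵢᵀM‖`. -/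
noncomputable def gammaKM {n : ℕ} {C : Type*} [Fintype C] (k m : ℕ)
    (M : Matrix (Fin n) C ℝ) : ℝ :=
  supOver (fun i => m ≤ (i : ℕ)) (rowNorm M) / infOver (fun i => (i : ℕ) < k) (rowNorm M)

/-- Spectral (operator 2-) norm of a matrix. -/
noncomputable def specNorm {a b : Type*} [Fintype a] [Fintype b] [DecidableEq b]
    (M : Matrix a b ℝ) : ℝ :=
  ‖LinearMap.toContinuousLinearMap (Matrix.toEuclideanLin M)‖

/-- The Vandermonde matrix `V` with `V i j = λᵢ^j`, `0 ≤ j ≤ p`. -/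
def vand {n : ℕ} (lam : Fin n → ℝ) (p : ℕ) : Matrix (Fin n) (Fin (p + 1)) ℝ :=
  fun i j => lam i ^ (j : ℕ)

/-- The diagonal of `D`: `Dᵢᵢ = ‖qᵢᵀX‖₂ ⬝ ‖eᵢᵀV‖₂` (the norm of the `i`-th row of `Ĝ`). -/
noncomputable def dvec {n k : ℕ} (lam : Fin n → ℝ) (p : ℕ) (Q : Matrix (Fin n) (Fin n) ℝ)
    (X : Matrix (Fin n) (Fin k) ℝ) : Fin n → ℝ :=
  fun i => rowNorm (Qᵀ * X) i * rowNorm (vand lam p) i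

/-- `G = D† Ĝ`, where `Ĝ = [QᵀX, ΛQᵀX, …, ΛᵖQᵀX]`; the column block index is `j.1`. -/
noncomputable def gmat {n k : ℕ} (lam : Fin n → ℝ) (p : ℕ) (Q : Matrix (Fin n) (Fin n) ℝ)
    (X : Matrix (Fin n) (Fin k) ℝ) : Matrix (Fin n) (Fin (p + 1) × Fin k) ℝ :=
  fun i j => (dvec lam p Q X i)⁻¹ * (lam i ^ (j.1 : ℕ) * (Qᵀ * X) i j.2)

/-- The augmented matrix `X_p = [X, AX, …, AᵖX]`; the column block index is `j.1`. -/
noncomputable def aug {n k : ℕ} (A : Matrix (Fin n) (Fin n) ℝ)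
    (X : Matrix (Fin n) (Fin k) ℝ) (p : ℕ) : Matrix (Fin n) (Fin (p + 1) × Fin k) ℝ :=
  fun i j => (A ^ (j.1 : ℕ) * X) i j.2

/-- First `m` rows of a matrix. -/
def topRows {n : ℕ} {C : Type*} (m : ℕ) (hmn : m ≤ n) (M : Matrix (Fin n) C ℝ) :
    Matrix (Fin m) C ℝ :=
  fun i j => M (Fin.castLE hmn i) j

/-- Last `n - m` rows of a matrix. -/
def lowRows {n : ℕ} {C : Type*} (m : ℕ) (hmn : m ≤ n) (M : Matrix (Fin n) C ℝ) :
    Matrix (Fin (n - m)) C ℝ :=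
  fun i j => M ⟨m + (i : ℕ), by have := i.isLt; omega⟩ j

/-- First `m` columns of a square matrix (`Q_m`). -/
def colsTop {n : ℕ} (m : ℕ) (hmn : m ≤ n) (M : Matrix (Fin n) (Fin n) ℝ) :
    Matrix (Fin n) (Fin m) ℝ :=
  fun i j => M i (Fin.castLE hmn j)

/-- Last `n - m` columns of a square matrix (`Q_{m+}`). -/
def colsLow {n : ℕ} (m : ℕ) (hmn : m ≤ n) (M : Matrix (Fin n) (Fin n) ℝ) :
    Matrix (Fin n) (Fin (n - m)) ℝ :=
  fun i j => M i ⟨m + (j : ℕ), by have := j.isLt; omega⟩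

/-- `E_k`: the first `k` columns of the `m × m` identity matrix. -/
def ekMat (m k : ℕ) : Matrix (Fin m) (Fin k) ℝ :=
  fun i j => if (i : ℕ) = (j : ℕ) then 1 else 0

/-- `D₁⁻¹`: the inverse of the leading `m × m` block of `D`. -/
noncomputable def d1inv {n : ℕ} (m : ℕ) (hmn : m ≤ n) (d : Fin n → ℝ) :
    Matrix (Fin m) (Fin m) ℝ :=
  Matrix.diagonal fun i => (d (Fin.castLE hmn i))⁻¹

/-- `D₂`: the trailing `(n-m) × (n-m)` block of `D`. -/
noncomputable def d2mat {n : ℕ} (m : ℕ) (hmn : m ≤ n) (d : Fin n → ℝ) :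
    Matrix (Fin (n - m)) (Fin (n - m)) ℝ :=
  Matrix.diagonal fun i => d ⟨m + (i : ℕ), by have := i.isLt; omega⟩

/-- `Y = X_p G₁† D₁⁻¹ E_k`, where `A = Q Λ Qᵀ` and `X_p = [X, AX, …, AᵖX]`. -/
noncomputable def ymat {n k : ℕ} (m : ℕ) (hmn : m ≤ n) (lam : Fin n → ℝ) (p : ℕ)
    (Q : Matrix (Fin n) (Fin n) ℝ) (X : Matrix (Fin n) (Fin k) ℝ)
    (Gpinv : Matrix (Fin (p + 1) × Fin k) (Fin m) ℝ) : Matrix (Fin n) (Fin k) ℝ :=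
  aug (Q * Matrix.diagonal lam * Qᵀ) X p * Gpinv * d1inv m hmn (dvec lam p Q X) * ekMat m k

end ARR

namespace ARR

section RowNorm

variable {R S C : Type*} [Fintype C]

lemma rowNorm_nonneg (M : Matrix R C ℝ) (i : R) : 0 ≤ rowNorm M i := Real.sqrt_nonneg _

lemma rowNorm_eq_norm (M : Matrix R C ℝ) (i : R) : rowNorm M i = ‖WithLp.toLp 2 (M i)‖ := by
  simp [rowNorm, EuclideanSpace.norm_eq]

lemma rowNorm_eq_zero_iff (M : Matrix R C ℝ) (i : R) : rowNorm M i = 0 ↔ M i = 0 := by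
  simp [rowNorm_eq_norm]

lemma abs_entry_le_rowNorm (M : Matrix R C ℝ) (i : R) (j : C) : |M i j| ≤ rowNorm M i :=
  Real.abs_le_sqrt (Finset.single_le_sum (f := fun j => M i j ^ 2)
    (fun _ _ => sq_nonneg _) (Finset.mem_univ j))

lemma rowNorm_diagonal_mul [Fintype R] [DecidableEq R] (d : R → ℝ) (M : Matrix R C ℝ) (i : R) :
    rowNorm (diagonal d * M) i = |d i| * rowNorm M i := by
  simp only [rowNorm, diagonal_mul, mul_pow, ← Finset.mul_sum]
  rw [Real.sqrt_mul (sq_nonneg _), Real.sqrt_sq_eq_abs]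

lemma rowNorm_mul_diagonal_le [DecidableEq C] (M : Matrix R C ℝ) (c : C → ℝ) {b : ℝ}
    (hb : 0 ≤ b) (hc : ∀ j, |c j| ≤ b) (i : R) :
    rowNorm (M * diagonal c) i ≤ rowNorm M i * b := by
  rw [rowNorm, rowNorm, ← Real.sqrt_sq hb, ← Real.sqrt_mul (by positivity)]
  refine Real.sqrt_le_sqrt ?_
  rw [Finset.sum_mul]
  refine Finset.sum_le_sum fun j _ => ?_
  rw [mul_diagonal, mul_pow]
  exact mul_le_mul_of_nonneg_left (sq_le_sq.2 ((hc j).trans (le_abs_self b))) (sq_nonneg _)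

open scoped Matrix.Norms.L2Operator in
lemma rowNorm_mul_le [Fintype S] [DecidableEq S] [DecidableEq C] (M : Matrix R S ℝ)
    (N : Matrix S C ℝ) (i : R) : rowNorm (M * N) i ≤ rowNorm M i * specNorm N := by
  have h := l2_opNorm_mulVec Nᴴ (WithLp.toLp 2 (M i))
  rw [l2_opNorm_conjTranspose, mul_comm] at h
  rw [rowNorm_eq_norm, rowNorm_eq_norm, show specNorm N = ‖N‖ from (l2_opNorm_def N).symm]
  convert h using 2
  congr 1
  ext j
  simp [mul_apply, mulVec, dotProduct, mul_comm]

end RowNorm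

lemma specNorm_nonneg {a b : Type*} [Fintype a] [Fintype b] [DecidableEq b]
    (M : Matrix a b ℝ) : 0 ≤ specNorm M := norm_nonneg _

section Extrema

variable {n : ℕ} {P : Fin n → Prop} {f : Fin n → ℝ}

lemma le_supOver {i : Fin n} (hi : P i) : f i ≤ supOver P f :=
  le_csSup (Set.toFinite _).bddAbove ⟨i, hi, rfl⟩

lemma infOver_le {i : Fin n} (hi : P i) : infOver P f ≤ f i :=
  csInf_le (Set.toFinite _).bddBelow ⟨i, hi, rfl⟩

lemma supOver_le {b : ℝ} (hb : 0 ≤ b) (h : ∀ i, P i → f i ≤ b) : supOver P f ≤ b :=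
  Real.sSup_le (by rintro _ ⟨i, hi, rfl⟩; exact h i hi) hb

lemma supOver_nonneg (hf : ∀ i, 0 ≤ f i) : 0 ≤ supOver P f :=
  Real.sSup_nonneg (by rintro _ ⟨i, _, rfl⟩; exact hf i)

lemma infOver_eq_of_const {b : ℝ} {i : Fin n} (hi : P i) (h : ∀ i, P i → f i = b) :
    infOver P f = b := by
  refine le_antisymm ((infOver_le hi).trans_eq (h i hi)) (le_csInf ⟨_, i, hi, rfl⟩ ?_)
  rintro _ ⟨j, hj, rfl⟩
  exact (h j hj).ge

end Extrema

lemma one_le_rowNorm_vand {n : ℕ} (lam : Fin n → ℝ) (p : ℕ) (i : Fin n) :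
    1 ≤ rowNorm (vand lam p) i := by
  simpa [vand] using abs_entry_le_rowNorm (vand lam p) i 0

section Krylov

variable {n k : ℕ} (lam : Fin n → ℝ) (p : ℕ) (Q : Matrix (Fin n) (Fin n) ℝ)
  (X : Matrix (Fin n) (Fin k) ℝ)

lemma dvec_nonneg (i : Fin n) : 0 ≤ dvec lam p Q X i :=
  mul_nonneg (rowNorm_nonneg _ _) (rowNorm_nonneg _ _)

/-- The entries of the Krylov block matrix in the eigenbasis, recovered from `D` and `G`. -/
lemma dvec_mul_gmat (i : Fin n) (j : Fin (p + 1) × Fin k) :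
    dvec lam p Q X i * gmat lam p Q X i j = lam i ^ (j.1 : ℕ) * (Qᵀ * X) i j.2 := by
  by_cases hd : dvec lam p Q X i = 0
  · have hrow : (Qᵀ * X) i = 0 := by
      rw [← rowNorm_eq_zero_iff]
      exact (mul_eq_zero.1 hd).resolve_right
        (zero_lt_one.trans_le (one_le_rowNorm_vand lam p i)).ne'
    simp [hd, hrow]
  · exact mul_inv_cancel_left₀ hd _

lemma conj_pow {Q : Matrix (Fin n) (Fin n) ℝ} (hQ : Q * Qᵀ = 1) (hQ' : Qᵀ * Q = 1)
    (L : Matrix (Fin n) (Fin n) ℝ) (j : ℕ) : (Q * L * Qᵀ) ^ j = Q * L ^ j * Qᵀ := by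
  induction j with
  | zero => simp [hQ]
  | succ j ih =>
    calc (Q * L * Qᵀ) ^ (j + 1) = Q * L ^ j * (Qᵀ * Q) * L * Qᵀ := by
          rw [pow_succ, ih]; simp only [Matrix.mul_assoc]
      _ = Q * L ^ (j + 1) * Qᵀ := by rw [hQ', Matrix.mul_one, pow_succ, Matrix.mul_assoc Q]

lemma transpose_mul_aug {Q : Matrix (Fin n) (Fin n) ℝ} (hQ : Q * Qᵀ = 1) (hQ' : Qᵀ * Q = 1) :
    Qᵀ * aug (Q * diagonal lam * Qᵀ) X p = diagonal (dvec lam p Q X) * gmat lam p Q X := by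
  ext i j
  rw [diagonal_mul, dvec_mul_gmat]
  have h : Qᵀ * ((Q * diagonal lam * Qᵀ) ^ (j.1 : ℕ) * X) =
      diagonal (lam ^ (j.1 : ℕ)) * (Qᵀ * X) := by
    rw [conj_pow hQ hQ', diagonal_pow]
    simp only [← Matrix.mul_assoc, hQ', Matrix.one_mul]
  have h' := congrFun (congrFun h i) j.2
  rw [diagonal_mul] at h'
  exact h'

lemma rowNorm_gmat_le (i : Fin n) : rowNorm (gmat lam p Q X) i ≤ 1 := by
  let H : Matrix (Fin n) (Fin (p + 1) × Fin k) ℝ :=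
    of fun i j => lam i ^ (j.1 : ℕ) * (Qᵀ * X) i j.2
  have hH : rowNorm H i = dvec lam p Q X i := by
    simp only [dvec, rowNorm, H, of_apply]
    rw [← Real.sqrt_mul (Finset.sum_nonneg fun _ _ => sq_nonneg _), Fintype.sum_prod_type,
      mul_comm, Finset.sum_mul_sum]
    simp [vand, mul_pow]
  have hg : gmat lam p Q X = diagonal (fun i => (dvec lam p Q X i)⁻¹) * H := by
    ext i j
    rw [diagonal_mul]
    rfl
  rw [hg, rowNorm_diagonal_mul, hH, abs_inv, abs_of_nonneg (dvec_nonneg lam p Q X i)]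
  exact inv_mul_le_one

lemma d1inv_mul_ekMat {m : ℕ} (hmn : m ≤ n) (hkm : k ≤ m) (d : Fin n → ℝ) :
    d1inv m hmn d * ekMat m k =
      ekMat m k * diagonal fun j => (d (Fin.castLE (hkm.trans hmn) j))⁻¹ := by
  ext i j
  rw [d1inv, diagonal_mul, mul_diagonal, ekMat]
  split_ifs with h
  · rw [mul_one, one_mul]
    congr 2
    ext
    simpa using h
  · simp

variable {m : ℕ} (hmn : m ≤ n) (Gpinv : Matrix (Fin (p + 1) × Fin k) (Fin m) ℝ)

lemma transpose_mul_ymat {Q : Matrix (Fin n) (Fin n) ℝ} (hQ : Q * Qᵀ = 1) (hQ' : Qᵀ * Q = 1)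
    (hkm : k ≤ m) :
    Qᵀ * ymat m hmn lam p Q X Gpinv =
      diagonal (dvec lam p Q X) * (gmat lam p Q X * (Gpinv * ekMat m k) *
        diagonal fun j => (dvec lam p Q X (Fin.castLE (hkm.trans hmn) j))⁻¹) := by
  rw [ymat, Matrix.mul_assoc _ (d1inv m hmn _), d1inv_mul_ekMat hmn hkm]
  simp only [← Matrix.mul_assoc]
  rw [transpose_mul_aug lam p X hQ hQ']

variable {lam p Q X hmn Gpinv}

lemma gmat_mul_castLE (hG1 : topRows m hmn (gmat lam p Q X) * Gpinv = 1) (i j : Fin m) :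
    (gmat lam p Q X * Gpinv) (Fin.castLE hmn i) j = if i = j then 1 else 0 :=
  (congrFun (congrFun hG1 i) j).trans (one_apply)

lemma dvec_ne_zero (hG1 : topRows m hmn (gmat lam p Q X) * Gpinv = 1) (i : Fin m) :
    dvec lam p Q X (Fin.castLE hmn i) ≠ 0 := by
  intro hd
  have h := gmat_mul_castLE hG1 i i
  simp [mul_apply, gmat, hd] at h

/-- In the eigenbasis, the first `m` rows of `Y` are `E_k`. -/
lemma transpose_mul_ymat_castLE (hQ : Q * Qᵀ = 1) (hQ' : Qᵀ * Q = 1) (hkm : k ≤ m)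
    (hG1 : topRows m hmn (gmat lam p Q X) * Gpinv = 1) (i : Fin m) (j : Fin k) :
    (Qᵀ * ymat m hmn lam p Q X Gpinv) (Fin.castLE hmn i) j = ekMat m k i j := by
  rw [transpose_mul_ymat lam p X hmn Gpinv hQ hQ' hkm, diagonal_mul, mul_diagonal,
    ← Matrix.mul_assoc, mul_apply]
  simp only [gmat_mul_castLE hG1, ite_mul, one_mul, zero_mul, Finset.sum_ite_eq, Finset.mem_univ,
    if_true]
  rw [ekMat]
  split_ifs with h
  · have hij : Fin.castLE (hkm.trans hmn) j = Fin.castLE hmn i := by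
      ext
      simpa using h.symm
    rw [hij, one_mul, mul_inv_cancel₀ (dvec_ne_zero hG1 i)]
  · simp

lemma rowNorm_ymat_of_lt (hQ : Q * Qᵀ = 1) (hQ' : Qᵀ * Q = 1) (hkm : k ≤ m)
    (hG1 : topRows m hmn (gmat lam p Q X) * Gpinv = 1) {i : Fin n} (hi : (i : ℕ) < m) :
    rowNorm (Qᵀ * ymat m hmn lam p Q X Gpinv) i = if (i : ℕ) < k then 1 else 0 := by
  have hrow : ∀ j, (Qᵀ * ymat m hmn lam p Q X Gpinv) i j = if (i : ℕ) = (j : ℕ) then 1 else 0 :=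
    transpose_mul_ymat_castLE hQ hQ' hkm hG1 ⟨i, hi⟩
  simp only [rowNorm, hrow]
  split_ifs with h
  · rw [Finset.sum_eq_single ⟨i, h⟩]
    · simp
    · intro j _ hj
      have : (i : ℕ) ≠ j := fun h' => hj (Fin.ext h'.symm)
      simp [this]
    · simp
  · have : ∀ j : Fin k, (i : ℕ) ≠ j := fun j => by omega
    simp [this]

lemma rowNorm_ymat_le (hQ : Q * Qᵀ = 1) (hQ' : Qᵀ * Q = 1) (hkm : k ≤ m) {b : ℝ} (hb : 0 < b)
    (hd : ∀ j : Fin n, (j : ℕ) < k → b ≤ dvec lam p Q X j) (i : Fin n) :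
    rowNorm (Qᵀ * ymat m hmn lam p Q X Gpinv) i ≤
      dvec lam p Q X i * (specNorm (Gpinv * ekMat m k) * b⁻¹) := by
  rw [transpose_mul_ymat lam p X hmn Gpinv hQ hQ' hkm, rowNorm_diagonal_mul,
    abs_of_nonneg (dvec_nonneg lam p Q X i)]
  refine mul_le_mul_of_nonneg_left ?_ (dvec_nonneg lam p Q X i)
  refine (rowNorm_mul_diagonal_le _ _ (inv_nonneg.2 hb.le) (fun j => ?_) i).trans ?_
  · rw [abs_inv, abs_of_nonneg (dvec_nonneg lam p Q X _)]
    exact inv_anti₀ hb (hd _ j.2)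
  · refine mul_le_mul_of_nonneg_right ?_ (inv_nonneg.2 hb.le)
    exact (rowNorm_mul_le _ _ i).trans
      (mul_le_of_le_one_left (specNorm_nonneg _) (rowNorm_gmat_le lam p Q X i))

lemma dvec_filter (hQ' : Qᵀ * Q = 1) {X₀ : Matrix (Fin n) (Fin k) ℝ} (r : Fin n → ℝ) (q : ℕ)
    (i : Fin n) :
    dvec lam p Q (Q * diagonal r ^ q * Qᵀ * X₀) i =
      |r i| ^ q * rowNorm (Qᵀ * X₀) i * rowNorm (vand lam p) i := by
  have h : Qᵀ * (Q * diagonal r ^ q * Qᵀ * X₀) = diagonal (r ^ q) * (Qᵀ * X₀) := by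
    rw [diagonal_pow]
    simp only [← Matrix.mul_assoc, hQ', Matrix.one_mul]
  rw [dvec, h, rowNorm_diagonal_mul, Pi.pow_apply, abs_pow]

end Krylov

end ARR

open ARR in
/-- Theorem 3.2, first part. With `X = ρ(A)^q X₀`, under the ordering
condition on `|ρ(λⱼ)|` and the `G₁`-Assumption,
`δₖ(Y) ≤ c_m |ρ(λ_{m+1})/ρ(λ_k)|^q` where
`c_m = Γ_{k,m}(QᵀX₀) Γ_{k,m}(V) ‖G₁†E_k‖₂`. (0-based indices: `λ_k = lam ⟨k-1⟩`,
`λ_{m+1} = lam ⟨m⟩`.) -/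
theorem arr_thm2_part1 {n k p m q : ℕ} (hq : 1 ≤ q) (hk : 0 < k) (hn : (p + 1) * k < n)
    (hkm : k ≤ m) (hmk : m ≤ k + p * k) (hm : m < n)
    (lam : Fin n → ℝ) (hlam : Antitone lam)
    (Q : Matrix (Fin n) (Fin n) ℝ) (hQ : Q * Qᵀ = 1) (hQ' : Qᵀ * Q = 1)
    (ρ : ℝ → ℝ) (X₀ X : Matrix (Fin n) (Fin k) ℝ)
    (hX : X = Q * (Matrix.diagonal fun i => ρ (lam i)) ^ q * Qᵀ * X₀)
    (hordmin : ∀ j : Fin n, (j : ℕ) < k → |ρ (lam ⟨k - 1, by omega⟩)| ≤ |ρ (lam j)|)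
    (horddec : ∀ i j : Fin n, k - 1 ≤ (i : ℕ) → (i : ℕ) ≤ (j : ℕ) → (j : ℕ) ≤ m →
      |ρ (lam j)| ≤ |ρ (lam i)|)
    (hordmax : ∀ j : Fin n, m ≤ (j : ℕ) → |ρ (lam j)| ≤ |ρ (lam ⟨m, hm⟩)|)
    (hρk : ρ (lam ⟨k - 1, by omega⟩) ≠ 0)
    (hX₀ : 0 < infOver (fun i => (i : ℕ) < k) (rowNorm (Qᵀ * X₀)))
    (hV : 0 < infOver (fun i => (i : ℕ) < k) (rowNorm (vand lam p)))
    (Gpinv : Matrix (Fin (p + 1) × Fin k) (Fin m) ℝ)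
    (hG1 : topRows m hm.le (gmat lam p Q X) * Gpinv = 1) :
    deltaK Q (ymat m hm.le lam p Q X Gpinv) ≤
      (gammaKM k m (Qᵀ * X₀) * gammaKM k m (vand lam p) * specNorm (Gpinv * ekMat m k)) *
        |ρ (lam ⟨m, hm⟩) / ρ (lam ⟨k - 1, by omega⟩)| ^ q := by
  set xk := infOver (fun i => (i : ℕ) < k) (rowNorm (Qᵀ * X₀))
  set vk := infOver (fun i => (i : ℕ) < k) (rowNorm (vand lam p))
  set xm := supOver (fun i => m ≤ (i : ℕ)) (rowNorm (Qᵀ * X₀))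
  set vm := supOver (fun i => m ≤ (i : ℕ)) (rowNorm (vand lam p))
  set s := specNorm (Gpinv * ekMat m k)
  set rk := ρ (lam ⟨k - 1, by omega⟩)
  set rm := ρ (lam ⟨m, hm⟩)
  have hxm0 : 0 ≤ xm := supOver_nonneg (rowNorm_nonneg _)
  have hvm0 : 0 ≤ vm := supOver_nonneg (rowNorm_nonneg _)
  have hs0 : 0 ≤ s := specNorm_nonneg _
  have hrk : 0 < |rk| := abs_pos.2 hρk
  have hd : ∀ i, dvec lam p Q X i =
      |ρ (lam i)| ^ q * rowNorm (Qᵀ * X₀) i * rowNorm (vand lam p) i := fun i => by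
    rw [hX, dvec_filter hQ' (fun i => ρ (lam i))]
  have hlow : ∀ j : Fin n, (j : ℕ) < k → |rk| ^ q * xk * vk ≤ dvec lam p Q X j := fun j hj => by
    rw [hd]
    have hr := hordmin j hj
    have hx : xk ≤ rowNorm (Qᵀ * X₀) j := infOver_le (P := fun i : Fin n => (i : ℕ) < k) hj
    have hv : vk ≤ rowNorm (vand lam p) j := infOver_le (P := fun i : Fin n => (i : ℕ) < k) hj
    have := rowNorm_nonneg (Qᵀ * X₀) j
    gcongr
  have hhigh : ∀ j : Fin n, m ≤ (j : ℕ) → dvec lam p Q X j ≤ |rm| ^ q * xm * vm := fun j hj => by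
    rw [hd]
    have hr := hordmax j hj
    have hx : rowNorm (Qᵀ * X₀) j ≤ xm := le_supOver (P := fun i : Fin n => m ≤ (i : ℕ)) hj
    have hv : rowNorm (vand lam p) j ≤ vm := le_supOver (P := fun i : Fin n => m ≤ (i : ℕ)) hj
    have := rowNorm_nonneg (Qᵀ * X₀) j
    have := rowNorm_nonneg (vand lam p) j
    gcongr
  have hb : 0 < |rk| ^ q * xk * vk := by positivity
  have hinf : infOver (fun i => (i : ℕ) < k)
      (rowNorm (Qᵀ * ymat m hm.le lam p Q X Gpinv)) = 1 :=
    infOver_eq_of_const (P := fun i : Fin n => (i : ℕ) < k) (i := ⟨0, by omega⟩) hk fun i hi => by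
      rw [rowNorm_ymat_of_lt hQ hQ' hkm hG1 (hi.trans_le hkm), if_pos hi]
  have hbound : gammaKM k m (Qᵀ * X₀) * gammaKM k m (vand lam p) * s * |rm / rk| ^ q =
      |rm| ^ q * xm * vm * (s * (|rk| ^ q * xk * vk)⁻¹) := by
    change xm / xk * (vm / vk) * s * |rm / rk| ^ q = _
    rw [abs_div, div_pow]
    field_simp
  rw [hbound, deltaK, hinf, div_one]
  refine supOver_le (by positivity) fun i hi => ?_
  by_cases him : (i : ℕ) < m
  · rw [rowNorm_ymat_of_lt hQ hQ' hkm hG1 him, if_neg (not_lt.2 hi)]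
    positivity
  · exact (rowNorm_ymat_le hQ hQ' hkm hb hlow i).trans
      (mul_le_mul_of_nonneg_right (hhigh i (not_lt.1 him)) (by positivity))
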